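/- arXiv:1210.3135 — 3 statements merged into one kernel-verified Lean document; each statement's English description precedes it below -/
import Mathlib

section
/- Let U ∈ ℝ^{n×d} be a matrix such that ‖x‖_∞ ≤ ‖Ux‖₁ for all x ∈ ℝ^d, and let Π ∈ ℝ^{s×n} be any matrix with |ΠU|₁ ≤ M for some M > 0, where |·|₁ denotes the entrywise (element-wise) ℓ₁ norm of a matrix. Then for every y in the column space of U, ‖Πy‖₁ ≤ M·‖y‖₁. -/
open Matrix

/-- The ℓ₁ norm of a vector. -/
noncomputable def l1norm {n : ℕ} (x : Fin n → ℝ) : ℝ := ∑ i, |x i|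

/-- The ℓ_∞ norm of a vector. -/
noncomputable def linfnorm {n : ℕ} (x : Fin n → ℝ) : ℝ := ⨆ i, |x i|

/-- The entrywise ℓ₁ norm of a matrix. -/
noncomputable def matrixL1 {m n : ℕ} (B : Matrix (Fin m) (Fin n) ℝ) : ℝ :=
  ∑ i, ∑ j, |B i j|

/-- if `‖x‖_∞ ≤ ‖Ux‖₁` for all `x` and `|ΠU|₁ ≤ M`, then
`‖Πy‖₁ ≤ M ‖y‖₁` for every `y` in the column space of `U`. -/
theorem upper_bound_via_entrywise_l1
    {n d s : ℕ} (U : Matrix (Fin n) (Fin d) ℝ) (Pi : Matrix (Fin s) (Fin n) ℝ)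
    (hU : ∀ x : Fin d → ℝ, linfnorm x ≤ l1norm (U.mulVec x))
    (M : ℝ) (hM : 0 < M) (hPiU : matrixL1 (Pi * U) ≤ M)
    (y : Fin n → ℝ) (hy : ∃ x : Fin d → ℝ, y = U.mulVec x) :
    l1norm (Pi.mulVec y) ≤ M * l1norm y := by
  obtain ⟨x, rfl⟩ := hy
  have hx : ∀ j, |x j| ≤ l1norm (U.mulVec x) := fun j =>
    (le_ciSup (f := fun i => |x i|) (Set.finite_range _).bddAbove j).trans (hU x)
  have h0 : 0 ≤ l1norm (U.mulVec x) := Finset.sum_nonneg fun i _ => abs_nonneg _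
  refine le_trans ?_ (mul_le_mul_of_nonneg_right hPiU h0)
  rw [Matrix.mulVec_mulVec]
  generalize l1norm (U.mulVec x) = c at *
  unfold l1norm matrixL1
  rw [Finset.sum_mul]
  refine Finset.sum_le_sum fun i _ => ?_
  rw [Finset.sum_mul]
  unfold Matrix.mulVec dotProduct
  refine (Finset.abs_sum_le_sum_abs (fun j => (Pi * U) i j * x j) Finset.univ).trans (Finset.sum_le_sum fun j _ => ?_)
  rw [abs_mul]
  exact mul_le_mul_of_nonneg_left (hx j) (abs_nonneg _)
end

section
/- Let A ∈ ℝ^{n×d} have full column rank and let p ∈ [1, ∞). Define σ_p^max(A) = max_{‖x‖₂≤1} ‖Ax‖_p, σ_p^min(A) = min_{‖x‖₂=1} ‖Ax‖_p, and κ_p(A) = σ_p^max(A)/σ_p^min(A). Let q be the dual exponent of p (1/p + 1/q = 1), say A is (α,β,p)-conditioned if |A|_p ≤ α and ‖z‖_q ≤ β·‖Az‖_p for all z ∈ ℝ^d, and let κ̄_p(A) be the infimum of α·β over all pairs (α,β) for which A is (α,β,p)-conditioned. Then d^{−|1/2 − 1/p|}·κ_p(A) ≤ κ̄_p(A) ≤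 d^{max(1/2, 1/p)}·κ_p(A). -/
open Matrix
open scoped ENNReal NNReal

/-- The Euclidean (ℓ₂) norm of a vector. -/
noncomputable def l2norm {n : ℕ} (x : Fin n → ℝ) : ℝ := Real.sqrt (∑ i, x i ^ 2)

/-- The ℓ_p norm of a vector, for a real exponent `p ≥ 1`. -/
noncomputable def lpnorm (p : ℝ) {n : ℕ} (x : Fin n → ℝ) : ℝ :=
  (∑ i, |x i| ^ p) ^ (1 / p)

/-- The ℓ_q norm of a vector for an extended-real exponent `q` (with `q = ∞` giving
the sup norm). -/
noncomputable def lqnormE (q : ℝ≥0∞) {n : ℕ} (x : Fin n → ℝ) : ℝ :=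
  if q = ∞ then ⨆ i, |x i| else (∑ i, |x i| ^ q.toReal) ^ (1 / q.toReal)

/-- The entrywise ℓ_p norm of a matrix. -/
noncomputable def matrixLp (p : ℝ) {m n : ℕ} (B : Matrix (Fin m) (Fin n) ℝ) : ℝ :=
  (∑ i, ∑ j, |B i j| ^ p) ^ (1 / p)

/-- `σ_p^max(A) = max_{‖x‖₂ ≤ 1} ‖Ax‖_p`. -/
noncomputable def sigmaMax (p : ℝ) {n d : ℕ} (A : Matrix (Fin n) (Fin d) ℝ) : ℝ :=
  sSup ((fun x => lpnorm p (A.mulVec x)) '' {x | l2norm x ≤ 1})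

/-- `σ_p^min(A) = min_{‖x‖₂ = 1} ‖Ax‖_p`. -/
noncomputable def sigmaMin (p : ℝ) {n d : ℕ} (A : Matrix (Fin n) (Fin d) ℝ) : ℝ :=
  sInf ((fun x => lpnorm p (A.mulVec x)) '' {x | l2norm x = 1})

/-- The ℓ_p-norm condition number `κ_p(A) = σ_p^max(A)/σ_p^min(A)`. -/
noncomputable def kappa (p : ℝ) {n d : ℕ} (A : Matrix (Fin n) (Fin d) ℝ) : ℝ :=
  sigmaMax p A / sigmaMin p A

/-- `κ̄_p(A)`: the infimum of `α·β` over all pairs for which `A` is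
`(α, β, p)`-conditioned, where `q` is the dual exponent of `p`. -/
noncomputable def kappaBar (p : ℝ) (q : ℝ≥0∞) {n d : ℕ}
    (A : Matrix (Fin n) (Fin d) ℝ) : ℝ :=
  sInf {r | ∃ α β : ℝ, r = α * β ∧ matrixLp p A ≤ α ∧
    ∀ z : Fin d → ℝ, lqnormE q z ≤ β * lpnorm p (A.mulVec z)}

lemma lpnorm_nonneg' (p : ℝ) {n : ℕ} (x : Fin n → ℝ) : 0 ≤ lpnorm p x := by
  unfold lpnorm; positivity

lemma lpnorm_rpow (p : ℝ) (hp : 0 < p) {n : ℕ} (x : Fin n → ℝ) :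
    lpnorm p x ^ p = ∑ i, |x i| ^ p := by
  unfold lpnorm
  rw [← Real.rpow_mul (by positivity), one_div_mul_cancel hp.ne', Real.rpow_one]

lemma l2norm_eq {n : ℕ} (x : Fin n → ℝ) : l2norm x = lpnorm 2 x := by
  unfold l2norm lpnorm
  rw [Real.sqrt_eq_rpow]
  simp

lemma abs_le_lpnorm (p : ℝ) (hp : 0 < p) {n : ℕ} (x : Fin n → ℝ) (i : Fin n) :
    |x i| ≤ lpnorm p x := by
  rw [← Real.rpow_le_rpow_iff (abs_nonneg _) (lpnorm_nonneg' p x) hp, lpnorm_rpow p hp]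
  exact Finset.single_le_sum (f := fun i => |x i| ^ p) (fun j _ => by positivity)
    (Finset.mem_univ i)

lemma lpnorm_pos (p : ℝ) (hp : 0 < p) {n : ℕ} (x : Fin n → ℝ) (hx : x ≠ 0) :
    0 < lpnorm p x := by
  obtain ⟨i, hi⟩ := Function.ne_iff.mp hx
  exact lt_of_lt_of_le (abs_pos.mpr hi) (abs_le_lpnorm p hp x i)

lemma lpnorm_smul (p : ℝ) (hp : 0 < p) {n : ℕ} (c : ℝ) (x : Fin n → ℝ) :
    lpnorm p (c • x) = |c| * lpnorm p x := by
  unfold lpnorm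
  simp only [Pi.smul_apply, smul_eq_mul, abs_mul]
  simp_rw [Real.mul_rpow (abs_nonneg c) (abs_nonneg _)]
  rw [← Finset.mul_sum, Real.mul_rpow (by positivity) (by positivity),
    ← Real.rpow_mul (by positivity), mul_one_div_cancel hp.ne', Real.rpow_one]

lemma lpnorm_mono (p : ℝ) (hp : 0 < p) {n : ℕ} (x y : Fin n → ℝ) (h : ∀ i, |x i| ≤ |y i|) :
    lpnorm p x ≤ lpnorm p y := by
  unfold lpnorm
  refine Real.rpow_le_rpow (by positivity) (Finset.sum_le_sum fun i _ => ?_) (by positivity)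
  exact Real.rpow_le_rpow (abs_nonneg _) (h i) hp.le

/-- Comparison of norms. -/
lemma lpnorm_compare (r s : ℝ) (hr : 0 < r) (hs : 0 < s) {d : ℕ} (hd : 0 < d)
    (x : Fin d → ℝ) :
    lpnorm s x ≤ (d : ℝ) ^ (max 0 (1 / s - 1 / r)) * lpnorm r x := by
  have hd' : (0 : ℝ) < d := by exact_mod_cast hd
  rcases le_total r s with h | h
  · have h1 : 1 / s - 1 / r ≤ 0 := by
      have := one_div_le_one_div_of_le hr h
      linarith
    rw [max_eq_left h1, Real.rpow_zero, one_mul,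
      ← Real.rpow_le_rpow_iff (lpnorm_nonneg' _ _) (lpnorm_nonneg' _ _) hs, lpnorm_rpow s hs]
    set N := lpnorm r x with hN
    have hN0 : 0 ≤ N := lpnorm_nonneg' _ _
    rcases hN0.eq_or_lt with h0 | h0
    · have : ∀ i, |x i| = 0 := fun i =>
        le_antisymm (h0 ▸ abs_le_lpnorm r hr x i) (abs_nonneg _)
      simp [this, Real.zero_rpow hs.ne', ← h0]
    · calc ∑ i, |x i| ^ s ≤ ∑ i, |x i| ^ r * N ^ (s - r) := by
            apply Finset.sum_le_sum
            intro i _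
            rcases (abs_nonneg (x i)).eq_or_lt with hi | hi
            · rw [← hi, Real.zero_rpow hs.ne', Real.zero_rpow hr.ne', zero_mul]
            · have : |x i| ^ s = |x i| ^ r * |x i| ^ (s - r) := by
                rw [← Real.rpow_add hi]; congr 1; ring
              rw [this]
              have h3 := abs_le_lpnorm r hr x i
              have h4 : |x i| ^ (s - r) ≤ N ^ (s - r) :=
                Real.rpow_le_rpow (abs_nonneg _) h3 (by linarith)
              gcongr
        _ = N ^ s := by
            rw [← Finset.sum_mul, ← lpnorm_rpow r hr, ← hN, ← Real.rpow_add h0]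
            congr 1; ring
  · have h1 : 0 ≤ 1 / s - 1 / r := by
      have := one_div_le_one_div_of_le hs h
      linarith
    rw [max_eq_right h1]
    have key := Real.rpow_sum_le_const_mul_sum_rpow_of_nonneg (Finset.univ)
      (f := fun i => |x i| ^ s) (p := r / s) ((one_le_div hs).mpr h)
      (fun i _ => by positivity)
    have e1 : ∀ i, (|x i| ^ s) ^ (r / s) = |x i| ^ r := fun i => by
      rw [← Real.rpow_mul (abs_nonneg _), mul_div_cancel₀ _ hs.ne']
    simp only [e1, Finset.card_univ, Fintype.card_fin] at key
    have key2 := Real.rpow_le_rpow (by positivity) key (one_div_pos.mpr hr).le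
    rw [Real.mul_rpow (by positivity) (by positivity), ← Real.rpow_mul (by positivity),
      ← Real.rpow_mul (by positivity)] at key2
    have e2 : r / s * (1 / r) = 1 / s := by field_simp
    have e3 : (r / s - 1) * (1 / r) = 1 / s - 1 / r := by field_simp
    rw [e2, e3] at key2
    exact key2

lemma conj_cases (p : ℝ) (hp : 1 ≤ p) (q : ℝ≥0∞)
    (hq : 1 / ENNReal.ofReal p + 1 / q = 1) :
    (p = 1 ∧ q = ∞) ∨ (q ≠ ∞ ∧ p.HolderConjugate q.toReal) := by
  have hp0 : (0 : ℝ) < p := by linarith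
  have hpne : ENNReal.ofReal p ≠ 0 := by simpa using hp0
  by_cases hqt : q = ∞
  · left
    refine ⟨?_, hqt⟩
    subst hqt
    simp at hq
    exact hq
  · right
    refine ⟨hqt, ?_⟩
    have hq0 : q ≠ 0 := by
      rintro rfl
      simp at hq
    have hqp : 0 < q.toReal := ENNReal.toReal_pos hq0 hqt
    have h := congrArg ENNReal.toReal hq
    rw [ENNReal.toReal_add (by simp [hp0]) (by simp [hq0])] at h
    simp [ENNReal.toReal_ofReal hp0.le] at h
    rw [Real.holderConjugate_iff]
    refine ⟨?_, h⟩
    have : p⁻¹ < 1 := by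
      have := inv_pos.mpr hqp
      linarith
    exact (inv_lt_one₀ hp0).mp this

lemma lq_le_l2 {d : ℕ} (hd : 0 < d) (p : ℝ) (hp : 1 ≤ p) (q : ℝ≥0∞)
    (hq : 1 / ENNReal.ofReal p + 1 / q = 1) (z : Fin d → ℝ) :
    lqnormE q z ≤ (d : ℝ) ^ (max 0 (1 / 2 - 1 / p)) * l2norm z := by
  have : Nonempty (Fin d) := ⟨⟨0, hd⟩⟩
  rw [l2norm_eq]
  rcases conj_cases p hp q hq with ⟨rfl, rfl⟩ | ⟨hqt, hpq⟩
  · rw [lqnormE, if_pos rfl, max_eq_left (by norm_num), Real.rpow_zero, one_mul]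
    exact ciSup_le fun i => abs_le_lpnorm 2 (by norm_num) z i
  · rw [lqnormE, if_neg hqt]
    have h := lpnorm_compare 2 q.toReal (by norm_num) hpq.symm.pos hd z
    have e : 1 / q.toReal - 1 / 2 = 1 / 2 - 1 / p := by
      have := (Real.holderConjugate_iff.mp hpq).2
      simp only [one_div]; linarith
    rw [e] at h
    exact h

lemma l2_le_lq {d : ℕ} (hd : 0 < d) (p : ℝ) (hp : 1 ≤ p) (q : ℝ≥0∞)
    (hq : 1 / ENNReal.ofReal p + 1 / q = 1) (z : Fin d → ℝ) :
    l2norm z ≤ (d : ℝ) ^ (max 0 (1 / p - 1 / 2)) * lqnormE q z := by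
  have : Nonempty (Fin d) := ⟨⟨0, hd⟩⟩
  rcases conj_cases p hp q hq with ⟨rfl, rfl⟩ | ⟨hqt, hpq⟩
  · rw [lqnormE, if_pos rfl, max_eq_right (by norm_num)]
    have hb : ∀ i, |z i| ≤ ⨆ i, |z i| := fun i =>
      le_ciSup (f := fun i => |z i|) (Set.finite_range _).bddAbove i
    have hM : 0 ≤ ⨆ i, |z i| := le_trans (abs_nonneg _) (hb ⟨0, hd⟩)
    have : (1 / 1 - 1 / 2 : ℝ) = 1 / 2 := by norm_num
    rw [this, ← Real.sqrt_eq_rpow, l2norm]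
    apply Real.sqrt_le_iff.mpr
    refine ⟨by positivity, ?_⟩
    rw [mul_pow, Real.sq_sqrt (by positivity)]
    calc ∑ i, z i ^ 2 ≤ ∑ _i : Fin d, (⨆ i, |z i|) ^ 2 := by
          apply Finset.sum_le_sum
          intro i _
          rw [← sq_abs]
          exact pow_le_pow_left₀ (abs_nonneg _) (hb i) 2
      _ = _ := by simp
  · rw [l2norm_eq, lqnormE, if_neg hqt]
    have h := lpnorm_compare q.toReal 2 hpq.symm.pos (by norm_num) hd z
    have e : 1 / 2 - 1 / q.toReal = 1 / p - 1 / 2 := by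
      have := (Real.holderConjugate_iff.mp hpq).2
      simp only [one_div]; linarith
    rw [e] at h
    exact h

lemma lqnormE_nonneg (q : ℝ≥0∞) {n : ℕ} (x : Fin n → ℝ) : 0 ≤ lqnormE q x := by
  unfold lqnormE
  split_ifs
  · exact Real.iSup_nonneg fun i => abs_nonneg _
  · positivity

lemma holder_vec {d : ℕ} (p : ℝ) (hp : 1 ≤ p) (q : ℝ≥0∞)
    (hq : 1 / ENNReal.ofReal p + 1 / q = 1) (a z : Fin d → ℝ) :
    |∑ j, a j * z j| ≤ lpnorm p a * lqnormE q z := by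
  refine (Finset.abs_sum_le_sum_abs _ _).trans ?_
  simp only [abs_mul]
  rcases conj_cases p hp q hq with ⟨rfl, rfl⟩ | ⟨hqt, hpq⟩
  · rw [lqnormE, if_pos rfl, lpnorm]
    simp only [Real.rpow_one, div_one, Finset.sum_mul]
    apply Finset.sum_le_sum
    intro i _
    exact mul_le_mul_of_nonneg_left
      (le_ciSup (f := fun i => |z i|) (Set.finite_range _).bddAbove i) (abs_nonneg _)
  · rw [lqnormE, if_neg hqt, lpnorm]
    have := Real.inner_le_Lp_mul_Lq Finset.univ (fun i => |a i|) (fun i => |z i|) hpq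
    simpa only [abs_abs] using this

lemma lpnorm_mulVec_le {n d : ℕ} (A : Matrix (Fin n) (Fin d) ℝ) (p : ℝ) (hp : 1 ≤ p) (q : ℝ≥0∞)
    (hq : 1 / ENNReal.ofReal p + 1 / q = 1) (z : Fin d → ℝ) :
    lpnorm p (A.mulVec z) ≤ matrixLp p A * lqnormE q z := by
  have hp0 : 0 < p := by linarith
  have h1 : matrixLp p A = lpnorm p (fun i => lpnorm p (A i)) := by
    unfold matrixLp
    rw [lpnorm]
    congr 1
    apply Finset.sum_congr rfl
    intro i _
    rw [abs_of_nonneg (lpnorm_nonneg' _ _), lpnorm_rpow p hp0]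
  have h2 := lpnorm_smul p hp0 (lqnormE q z) (fun i => lpnorm p (A i))
  rw [abs_of_nonneg (lqnormE_nonneg _ _)] at h2
  rw [h1, mul_comm, ← h2]
  apply lpnorm_mono p hp0
  intro i
  have := holder_vec p hp q hq (A i) z
  simp only [Pi.smul_apply, smul_eq_mul]
  rw [abs_of_nonneg (mul_nonneg (lqnormE_nonneg _ _) (lpnorm_nonneg' _ _)), mul_comm]
  exact this

lemma mulVec_inj {n d : ℕ} (A : Matrix (Fin n) (Fin d) ℝ) (hA : A.rank = d) :
    Function.Injective A.mulVec := by
  have h := LinearMap.finrank_range_add_finrank_ker A.mulVecLin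
  rw [← Matrix.rank, hA, Module.finrank_fin_fun] at h
  have h2 : Module.finrank ℝ (LinearMap.ker A.mulVecLin) = 0 := by omega
  rw [Submodule.finrank_eq_zero, LinearMap.ker_eq_bot] at h2
  exact h2

lemma l2norm_single {d : ℕ} (j : Fin d) : l2norm (Pi.single j (1 : ℝ)) = 1 := by
  unfold l2norm
  rw [Finset.sum_eq_single j]
  · simp
  · intro b _ hb
    simp [hb]
  · simp

lemma sigmaMin_pos {n d : ℕ} (hd : 0 < d)
    (A : Matrix (Fin n) (Fin d) ℝ) (hA : A.rank = d) (p : ℝ) (hp : 1 ≤ p) :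
    0 < sigmaMin p A := by
  have hp0 : 0 < p := by linarith
  have hcont : Continuous (fun x : Fin d → ℝ => lpnorm p (A.mulVec x)) := by
    unfold lpnorm
    refine Continuous.rpow_const ?_ (fun x => Or.inr (by positivity))
    refine continuous_finsetSum _ fun i _ => ?_
    refine Continuous.rpow_const ?_ (fun x => Or.inr hp0.le)
    have : Continuous fun x : Fin d → ℝ => A.mulVec x := by fun_prop
    exact ((continuous_apply i).comp this).abs
  have hl2 : Continuous (fun x : Fin d → ℝ => l2norm x) := by
    unfold l2norm
    fun_prop
  have hcomp : IsCompact {x : Fin d → ℝ | l2norm x = 1} := by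
    apply Metric.isCompact_of_isClosed_isBounded
    · exact isClosed_eq hl2 continuous_const
    · refine (Metric.isBounded_closedBall (x := (0 : Fin d → ℝ)) (r := 1)).subset ?_
      intro x hx
      rw [mem_closedBall_zero_iff, pi_norm_le_iff_of_nonneg zero_le_one]
      intro i
      rw [Real.norm_eq_abs]
      have h := abs_le_lpnorm 2 (by norm_num) x i
      rw [← l2norm_eq] at h
      exact h.trans (le_of_eq hx)
  have hne : {x : Fin d → ℝ | l2norm x = 1}.Nonempty := ⟨_, l2norm_single ⟨0, hd⟩⟩
  obtain ⟨x, hx, hxe⟩ := (hcomp.image hcont).sInf_mem (hne.image _)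
  unfold sigmaMin
  rw [← hxe]
  apply lpnorm_pos p hp0
  intro h0
  have : x = 0 := mulVec_inj A hA (by rw [h0, Matrix.mulVec_zero])
  subst this
  simp [l2norm] at hx

lemma sigmaMin_mul_le {n d : ℕ} (A : Matrix (Fin n) (Fin d) ℝ) (p : ℝ) (hp : 1 ≤ p)
    (z : Fin d → ℝ) : sigmaMin p A * l2norm z ≤ lpnorm p (A.mulVec z) := by
  have hp0 : 0 < p := by linarith
  by_cases hz : z = 0
  · subst hz
    have : l2norm (0 : Fin d → ℝ) = 0 := by simp [l2norm]
    rw [this, mul_zero]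
    exact lpnorm_nonneg' _ _
  · have hpos : 0 < l2norm z := by rw [l2norm_eq]; exact lpnorm_pos 2 (by norm_num) z hz
    have h1 : l2norm ((l2norm z)⁻¹ • z) = 1 := by
      rw [l2norm_eq ((l2norm z)⁻¹ • z), lpnorm_smul 2 (by norm_num), ← l2norm_eq,
        abs_of_pos (inv_pos.mpr hpos), inv_mul_cancel₀ hpos.ne']
    have h2 : sigmaMin p A ≤ lpnorm p (A.mulVec ((l2norm z)⁻¹ • z)) := by
      apply csInf_le
      · refine ⟨0, ?_⟩
        rintro _ ⟨x, _, rfl⟩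
        exact lpnorm_nonneg' _ _
      · exact ⟨_, h1, rfl⟩
    rw [Matrix.mulVec_smul, lpnorm_smul p hp0, abs_of_pos (inv_pos.mpr hpos)] at h2
    rw [inv_mul_eq_div, le_div_iff₀ hpos] at h2
    exact h2

lemma l2_bound {n d : ℕ} (hd : 0 < d) (A : Matrix (Fin n) (Fin d) ℝ) (p : ℝ) (hp : 1 ≤ p)
    (q : ℝ≥0∞) (hq : 1 / ENNReal.ofReal p + 1 / q = 1) (x : Fin d → ℝ) (hx : l2norm x ≤ 1) :
    lpnorm p (A.mulVec x) ≤ matrixLp p A * (d : ℝ) ^ (max 0 (1 / 2 - 1 / p)) := by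
  have hM : 0 ≤ matrixLp p A := by unfold matrixLp; positivity
  refine (lpnorm_mulVec_le A p hp q hq x).trans (mul_le_mul_of_nonneg_left ?_ hM)
  refine (lq_le_l2 hd p hp q hq x).trans ?_
  exact mul_le_of_le_one_right (by positivity) hx

lemma sigmaMax_le {n d : ℕ} (hd : 0 < d) (A : Matrix (Fin n) (Fin d) ℝ) (p : ℝ) (hp : 1 ≤ p)
    (q : ℝ≥0∞) (hq : 1 / ENNReal.ofReal p + 1 / q = 1) :
    sigmaMax p A ≤ matrixLp p A * (d : ℝ) ^ (max 0 (1 / 2 - 1 / p)) := by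
  apply csSup_le
  · exact ⟨_, _, (l2norm_single ⟨0, hd⟩).le, rfl⟩
  · rintro _ ⟨x, hx, rfl⟩
    exact l2_bound hd A p hp q hq x hx

lemma matrixLp_le {n d : ℕ} (hd : 0 < d) (A : Matrix (Fin n) (Fin d) ℝ) (p : ℝ) (hp : 1 ≤ p)
    (q : ℝ≥0∞) (hq : 1 / ENNReal.ofReal p + 1 / q = 1) :
    matrixLp p A ≤ (d : ℝ) ^ (1 / p) * sigmaMax p A := by
  have hp0 : 0 < p := by linarith
  have hcol : ∀ j, lpnorm p (A.mulVec (Pi.single j 1)) ≤ sigmaMax p A := by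
    intro j
    apply le_csSup
    · refine ⟨matrixLp p A * (d : ℝ) ^ (max 0 (1 / 2 - 1 / p)), ?_⟩
      rintro _ ⟨x, hx, rfl⟩
      exact l2_bound hd A p hp q hq x hx
    · exact ⟨_, (l2norm_single j).le, rfl⟩
  have hS : 0 ≤ sigmaMax p A := (lpnorm_nonneg' _ _).trans (hcol ⟨0, hd⟩)
  have h1 : ∑ i, ∑ j, |A i j| ^ p ≤ d * sigmaMax p A ^ p := by
    rw [Finset.sum_comm]
    calc ∑ j, ∑ i, |A i j| ^ p = ∑ j, lpnorm p (A.mulVec (Pi.single j 1)) ^ p := by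
          apply Finset.sum_congr rfl
          intro j _
          rw [lpnorm_rpow p hp0]
          simp [Matrix.mulVec_single]
      _ ≤ ∑ _j : Fin d, sigmaMax p A ^ p := by
          apply Finset.sum_le_sum
          intro j _
          exact Real.rpow_le_rpow (lpnorm_nonneg' _ _) (hcol j) hp0.le
      _ = _ := by simp
  unfold matrixLp
  calc _ ≤ (d * sigmaMax p A ^ p) ^ (1 / p) :=
        Real.rpow_le_rpow (by positivity) h1 (by positivity)
    _ = _ := by
        rw [Real.mul_rpow (by positivity) (by positivity), ← Real.rpow_mul hS,
          mul_one_div_cancel hp0.ne', Real.rpow_one]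

/-- equivalence of the two notions of ℓ_p-norm conditioning:
`d^{-|1/2 - 1/p|} κ_p(A) ≤ κ̄_p(A) ≤ d^{max(1/2, 1/p)} κ_p(A)`. -/
theorem kappa_kappaBar_equivalence
    {n d : ℕ} (hn : 0 < n) (hd : 0 < d)
    (A : Matrix (Fin n) (Fin d) ℝ) (hA : A.rank = d)
    (p : ℝ) (hp : 1 ≤ p)
    (q : ℝ≥0∞) (hq : 1 / ENNReal.ofReal p + 1 / q = 1) :
    (d : ℝ) ^ (-|1/2 - 1/p|) * kappa p A ≤ kappaBar p q A ∧
    kappaBar p q A ≤ (d : ℝ) ^ (max (1/2) (1/p)) * kappa p A := by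
  have hd' : (0 : ℝ) < d := by exact_mod_cast hd
  have hm := sigmaMin_pos hd A hA p hp
  have hM0 : 0 ≤ matrixLp p A := by unfold matrixLp; positivity
  have hS0 : 0 ≤ sigmaMax p A := by
    have := hM0.trans (matrixLp_le hd A p hp q hq)
    exact nonneg_of_mul_nonneg_right this (by positivity)
  have hlow : ∀ α β : ℝ, matrixLp p A ≤ α →
      (∀ z : Fin d → ℝ, lqnormE q z ≤ β * lpnorm p (A.mulVec z)) →
      (d : ℝ) ^ (-|1/2 - 1/p|) * kappa p A ≤ α * β := by
    intro α β hα hβ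
    have hβ' : ∀ z, l2norm z ≤
        (d : ℝ) ^ (max 0 (1 / p - 1 / 2)) * (β * lpnorm p (A.mulVec z)) := fun z =>
      (l2_le_lq hd p hp q hq z).trans (mul_le_mul_of_nonneg_left (hβ z) (by positivity))
    have hβ0 : 0 < β := by
      have h := hβ' (Pi.single ⟨0, hd⟩ 1)
      rw [l2norm_single] at h
      have h2 : 0 < (d : ℝ) ^ (max 0 (1 / p - 1 / 2)) *
        (β * lpnorm p (A.mulVec (Pi.single ⟨0, hd⟩ 1))) := lt_of_lt_of_le one_pos h
      have h3 := pos_of_mul_pos_right h2 (by positivity)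
      exact pos_of_mul_pos_left h3 (lpnorm_nonneg' _ _)
    have hmin : 1 ≤ (d : ℝ) ^ (max 0 (1 / p - 1 / 2)) * β * sigmaMin p A := by
      rw [← div_le_iff₀' (by positivity)]
      apply le_csInf
      · exact ⟨_, _, l2norm_single ⟨0, hd⟩, rfl⟩
      · rintro _ ⟨x, hx, rfl⟩
        have h := hβ' x
        rw [show l2norm x = 1 from hx, ← mul_assoc] at h
        rw [div_le_iff₀' (by positivity)]
        exact h
    have hmax : sigmaMax p A ≤ α * (d : ℝ) ^ (max 0 (1 / 2 - 1 / p)) :=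
      (sigmaMax_le hd A p hp q hq).trans (mul_le_mul_of_nonneg_right hα (by positivity))
    have hexp : |1/2 - 1/p| = max 0 (1 / 2 - 1 / p) + max 0 (1 / p - 1 / 2) := by
      rcases le_total (1 / p) (1 / 2) with h | h
      · rw [abs_of_nonneg (by linarith), max_eq_right (by linarith), max_eq_left (by linarith)]
        ring
      · rw [abs_of_nonpos (by linarith), max_eq_left (by linarith), max_eq_right (by linarith)]
        ring
    rw [Real.rpow_neg hd'.le, inv_mul_le_iff₀ (by positivity), hexp, Real.rpow_add hd', kappa,
      div_le_iff₀ hm]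
    have hα0 : 0 ≤ α := hM0.trans hα
    calc sigmaMax p A ≤ α * (d : ℝ) ^ (max 0 (1 / 2 - 1 / p)) * 1 := by rw [mul_one]; exact hmax
      _ ≤ α * (d : ℝ) ^ (max 0 (1 / 2 - 1 / p)) *
          ((d : ℝ) ^ (max 0 (1 / p - 1 / 2)) * β * sigmaMin p A) := by gcongr
      _ = _ := by ring
  have hmem : ∀ z : Fin d → ℝ, lqnormE q z ≤
      ((d : ℝ) ^ (max 0 (1 / 2 - 1 / p)) / sigmaMin p A) * lpnorm p (A.mulVec z) := by
    intro z
    refine (lq_le_l2 hd p hp q hq z).trans ?_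
    have h := sigmaMin_mul_le A p hp z
    rw [div_mul_eq_mul_div, le_div_iff₀ hm, mul_assoc]
    apply mul_le_mul_of_nonneg_left _ (by positivity)
    rw [mul_comm]; exact h
  constructor
  · apply le_csInf
    · exact ⟨_, _, _, rfl, le_rfl, hmem⟩
    · rintro r ⟨α, β, rfl, hα, hβ⟩
      exact hlow α β hα hβ
  · have h1 : kappaBar p q A ≤
        matrixLp p A * ((d : ℝ) ^ (max 0 (1 / 2 - 1 / p)) / sigmaMin p A) := by
      apply csInf_le
      · refine ⟨(d : ℝ) ^ (-|1/2 - 1/p|) * kappa p A, ?_⟩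
        rintro r ⟨α, β, rfl, hα, hβ⟩
        exact hlow α β hα hβ
      · exact ⟨_, _, rfl, le_rfl, hmem⟩
    have hexp : max (1 / 2) (1 / p) = 1 / p + max 0 (1 / 2 - 1 / p) := by
      rcases le_total (1 / p) (1 / 2) with h | h
      · rw [max_eq_left h, max_eq_right (by linarith)]; ring
      · rw [max_eq_right h, max_eq_left (by linarith)]; ring
    refine h1.trans ?_
    rw [hexp, Real.rpow_add hd', kappa]
    calc _ ≤ ((d : ℝ) ^ (1 / p) * sigmaMax p A) *
          ((d : ℝ) ^ (max 0 (1 / 2 - 1 / p)) / sigmaMin p A) :=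
          mul_le_mul_of_nonneg_right (matrixLp_le hd A p hp q hq) (by positivity)
      _ = _ := by ring
end

section
/- Let p ∈ [1, 2], A ∈ ℝ^{n×d} with full column rank, and let Π ∈ ℝ^{s×n} satisfy (1/κ₁)·‖Az‖_p ≤ ‖ΠAz‖_p ≤ κ₂·‖Az‖_p for all z ∈ ℝ^d, where κ₁, κ₂ ≥ 1. Suppose R ∈ ℝ^{d×d} is invertible and ΠAR⁻¹ has orthonormal columns (e.g., R is the triangular factor of a QR decomposition of ΠA). Then for all x ∈ ℝ^d: (1/κ₂)·‖x‖₂ ≤ ‖AR⁻¹x‖_p ≤ κ₁·s^{1/p − 1/2}·‖x‖₂. In particular, κ_p(AR⁻¹) ≤ κ₁·κ₂·s^{1/p − 1/2}. -/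
open Matrix

lemma l2norm_nonneg' {n : ℕ} (x : Fin n → ℝ) : 0 ≤ l2norm x := Real.sqrt_nonneg _

lemma l2_le_lp {n : ℕ} (p : ℝ) (hp1 : 1 ≤ p) (hp2 : p ≤ 2) (z : Fin n → ℝ) :
    l2norm z ≤ lpnorm p z := by
  have hp : 0 < p := by linarith
  unfold l2norm lpnorm
  set S := ∑ i, |z i| ^ p with hS
  have hS0 : 0 ≤ S := Finset.sum_nonneg fun i _ => Real.rpow_nonneg (abs_nonneg _) _
  apply Real.sqrt_le_iff.2
  refine ⟨Real.rpow_nonneg hS0 _, ?_⟩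
  have hi : ∀ i, |z i| ≤ S ^ (1 / p) := by
    intro i
    have h1 : |z i| ^ p ≤ S :=
      Finset.single_le_sum (f := fun i => |z i| ^ p)
        (fun i _ => Real.rpow_nonneg (abs_nonneg _) _) (Finset.mem_univ i)
    have h2 := Real.rpow_le_rpow (Real.rpow_nonneg (abs_nonneg _) _) h1
      (by positivity : 0 ≤ 1 / p)
    rwa [← Real.rpow_mul (abs_nonneg _), mul_one_div_cancel hp.ne', Real.rpow_one] at h2
  set T := S ^ (1 / p) with hT
  have hT0 : 0 ≤ T := Real.rpow_nonneg hS0 _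
  have hTS : T ^ p = S := by
    rw [hT, ← Real.rpow_mul hS0, one_div_mul_cancel hp.ne', Real.rpow_one]
  have hsq : ∀ y : ℝ, 0 ≤ y → y ^ 2 = y ^ p * y ^ (2 - p) := by
    intro y hy
    rw [← Real.rpow_add' hy (by norm_num)]
    simp
  calc ∑ i, z i ^ 2 ≤ ∑ i, |z i| ^ p * T ^ (2 - p) := by
        apply Finset.sum_le_sum
        intro i _
        rw [← sq_abs, hsq _ (abs_nonneg _)]
        exact mul_le_mul_of_nonneg_left
          (Real.rpow_le_rpow (abs_nonneg _) (hi i) (by linarith))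
          (Real.rpow_nonneg (abs_nonneg _) _)
    _ = T ^ 2 := by rw [← Finset.sum_mul, ← hS, hsq T hT0, hTS]

lemma lp_le_l2 {n : ℕ} (p : ℝ) (hp1 : 1 ≤ p) (hp2 : p ≤ 2) (z : Fin n → ℝ) :
    lpnorm p z ≤ (n : ℝ) ^ (1 / p - 1 / 2) * l2norm z := by
  have hp : 0 < p := by linarith
  unfold l2norm lpnorm
  have hS0 : 0 ≤ ∑ i, |z i| ^ p :=
    Finset.sum_nonneg fun i _ => Real.rpow_nonneg (abs_nonneg _) _
  have h := Real.rpow_sum_le_const_mul_sum_rpow (s := Finset.univ) (f := fun i => |z i| ^ p)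
    (p := 2 / p) (by rw [le_div_iff₀ hp]; linarith)
  have e1 : ∀ i, |(|z i| ^ p)| = |z i| ^ p := fun i =>
    abs_of_nonneg (Real.rpow_nonneg (abs_nonneg _) _)
  have e2 : ∀ i, (|z i| ^ p) ^ (2 / p) = z i ^ 2 := by
    intro i
    rw [← Real.rpow_mul (abs_nonneg _), mul_div_cancel₀ _ hp.ne']
    simp
  simp only [e1, e2, Finset.card_univ, Fintype.card_fin] at h
  have h2 := Real.rpow_le_rpow (Real.rpow_nonneg hS0 _) h (by norm_num : (0:ℝ) ≤ 1 / 2)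
  have hn : (0 : ℝ) ≤ n := Nat.cast_nonneg n
  rw [Real.mul_rpow (Real.rpow_nonneg hn _) (Finset.sum_nonneg fun i _ => sq_nonneg _),
    ← Real.rpow_mul hS0, ← Real.rpow_mul hn, ← Real.sqrt_eq_rpow] at h2
  have a1 : 2 / p * (1 / 2) = 1 / p := by ring
  have a2 : (2 / p - 1) * (1 / 2) = 1 / p - 1 / 2 := by ring
  rwa [a1, a2] at h2

lemma l2_isom {s d : ℕ} (B : Matrix (Fin s) (Fin d) ℝ) (h : Bᵀ * B = 1) (x : Fin d → ℝ) :
    l2norm (B.mulVec x) = l2norm x := by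
  have key : B.mulVec x ⬝ᵥ B.mulVec x = x ⬝ᵥ x := by
    rw [Matrix.dotProduct_mulVec, ← Matrix.mulVec_transpose, Matrix.mulVec_mulVec, h,
      Matrix.one_mulVec]
  unfold l2norm
  simp only [dotProduct, ← pow_two] at key
  rw [key]

/-- conditioning via a low-distortion embedding: if `Π` embeds the
column span of `A` with distortion `κ₁, κ₂` in ℓ_p and `ΠAR⁻¹` has orthonormal
columns, then `AR⁻¹` is well-conditioned:
`(1/κ₂)‖x‖₂ ≤ ‖AR⁻¹x‖_p ≤ κ₁ s^{1/p − 1/2} ‖x‖₂` and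
`κ_p(AR⁻¹) ≤ κ₁ κ₂ s^{1/p − 1/2}`. -/
theorem conditioning_via_embedding
    {n d s : ℕ} (hs : 0 < s) (hd : 0 < d)
    (p : ℝ) (hp1 : 1 ≤ p) (hp2 : p ≤ 2)
    (A : Matrix (Fin n) (Fin d) ℝ) (hA : A.rank = d)
    (Pi : Matrix (Fin s) (Fin n) ℝ)
    (κ₁ κ₂ : ℝ) (hκ₁ : 1 ≤ κ₁) (hκ₂ : 1 ≤ κ₂)
    (hdist : ∀ z : Fin d → ℝ,
      (1/κ₁) * lpnorm p (A.mulVec z) ≤ lpnorm p ((Pi * A).mulVec z) ∧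
      lpnorm p ((Pi * A).mulVec z) ≤ κ₂ * lpnorm p (A.mulVec z))
    (R : Matrix (Fin d) (Fin d) ℝ) (hR : IsUnit R.det)
    (horth : (Pi * A * R⁻¹)ᵀ * (Pi * A * R⁻¹) = 1) :
    (∀ x : Fin d → ℝ,
      (1/κ₂) * l2norm x ≤ lpnorm p ((A * R⁻¹).mulVec x) ∧
      lpnorm p ((A * R⁻¹).mulVec x) ≤ κ₁ * (s : ℝ) ^ (1/p - 1/2) * l2norm x) ∧
    kappa p (A * R⁻¹) ≤ κ₁ * κ₂ * (s : ℝ) ^ (1/p - 1/2) := by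
  have hk1 : 0 < κ₁ := by linarith
  have hk2 : 0 < κ₂ := by linarith
  have main : ∀ x : Fin d → ℝ,
      (1/κ₂) * l2norm x ≤ lpnorm p ((A * R⁻¹).mulVec x) ∧
      lpnorm p ((A * R⁻¹).mulVec x) ≤ κ₁ * (s : ℝ) ^ (1/p - 1/2) * l2norm x := by
    intro x
    obtain ⟨h1, h2⟩ := hdist (R⁻¹.mulVec x)
    rw [Matrix.mulVec_mulVec, Matrix.mulVec_mulVec] at h1 h2
    have hi := l2_isom _ horth x
    have h3 := l2_le_lp p hp1 hp2 ((Pi * A * R⁻¹).mulVec x)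
    have h4 := lp_le_l2 p hp1 hp2 ((Pi * A * R⁻¹).mulVec x)
    rw [hi] at h3 h4
    constructor
    · rw [one_div, inv_mul_le_iff₀ hk2]
      exact h3.trans h2
    · rw [one_div, inv_mul_le_iff₀ hk1] at h1
      rw [mul_assoc]
      exact h1.trans (mul_le_mul_of_nonneg_left h4 hk1.le)
  refine ⟨main, ?_⟩
  set C := (s : ℝ) ^ (1/p - 1/2) with hC
  have hC0 : 0 ≤ C := Real.rpow_nonneg (Nat.cast_nonneg s) _
  have hmax : sigmaMax p (A * R⁻¹) ≤ κ₁ * C := by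
    apply Real.sSup_le
    · rintro _ ⟨x, hx, rfl⟩
      exact (main x).2.trans (mul_le_of_le_one_right (by positivity) hx)
    · positivity
  have hmin : 1 / κ₂ ≤ sigmaMin p (A * R⁻¹) := by
    apply le_csInf
    · refine ⟨_, (fun i => if i = ⟨0, hd⟩ then 1 else 0), ?_, rfl⟩
      simp [l2norm]
    · rintro _ ⟨x, hx, rfl⟩
      have h := (main x).1
      rw [show l2norm x = 1 from hx, mul_one] at h
      exact h
  have hpos : 0 < 1 / κ₂ := by positivity
  unfold kappa
  rw [div_le_iff₀ (hpos.trans_le hmin)]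
  calc sigmaMax p (A * R⁻¹) ≤ κ₁ * C := hmax
    _ = κ₁ * κ₂ * C * (1 / κ₂) := by field_simp
    _ ≤ _ := mul_le_mul_of_nonneg_left hmin (by positivity)
end
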